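/- For every positive integer d there exists a finitely presented Lie algebra W⁺ over a field k of characteristic ≠ 2 (the wreath product A ≀ T⁺ with A abelian of dimension d and T⁺ abelian of dimension 2d, with Baumslag's presentation) whose growth function satisfies γ_{W⁺}(n) ∼ n^d. -/

import Mathlib

/-- Bracket monomials of a given length in the generating set `X`. -/
inductive IsBracketMonomial {L : Type*} [LieRing L] (X : Set L) : ℕ → L → Prop
  | base {x : L} : x ∈ X → IsBracketMonomial X 1 x
  | br {i j : ℕ} {u v : L} : IsBracketMonomial X i u → IsBracketMonomial X j v →
      IsBracketMonomial X (i + j) ⁅u, v⁆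

/-- The growth function of a Lie algebra with respect to a generating set `X`. -/
noncomputable def lieGrowth (k : Type*) {L : Type*} [Field k] [LieRing L]
    [LieAlgebra k L] (X : Set L) (n : ℕ) : ℕ :=
  Module.finrank k
    ↥(Submodule.span k {y : L | ∃ m : ℕ, m ≤ n ∧ IsBracketMonomial X m y})

namespace BaumslagWreath

section Relations

variable {k L ι : Type*} [Field k] [LieRing L] [LieAlgebra k L]

/-- The iterated bracket `⁅t i₁, ⁅t i₂, … ⁅t iᵣ, a⁆ … ⁆⁆` along a list of indices. -/
def word (a : L) (t : ι → L) (l : List ι) : L :=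
  l.foldr (fun i v => ⁅t i, v⁆) a

/-- Baumslag's relations: the `s p` commute, the second family acts on `a` as the square of the
first, and `a` commutes with its squarefree translates by the first family. -/
structure Relations (a : L) (s : ι ⊕ ι → L) : Prop where
  comm : ∀ p q, ⁅s p, s q⁆ = 0
  sq : ∀ i, ⁅s (.inr i), a⁆ = ⁅s (.inl i), ⁅s (.inl i), a⁆⁆
  squarefree : ∀ S : Finset ι, ⁅word a (fun i => s (.inl i)) S.toList, a⁆ = 0

namespace Relations

variable {a : L} {s : ι ⊕ ι → L}

lemma lie_lie_comm (h : Relations a s) (p q : ι ⊕ ι) (v : L) :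
    ⁅s p, ⁅s q, v⁆⁆ = ⁅s q, ⁅s p, v⁆⁆ := by
  rw [leibniz_lie, h.comm, zero_lie, zero_add]

lemma leftCommutative (h : Relations a s) :
    LeftCommutative fun (i : ι) (v : L) => ⁅s (.inl i), v⁆ :=
  ⟨fun _ _ _ => h.lie_lie_comm _ _ _⟩

/-- The translate of `a` by a monomial in the first family of commuting elements. -/
def translate (h : Relations a s) (m : Multiset ι) : L :=
  haveI := h.leftCommutative
  m.foldr (fun i v => ⁅s (.inl i), v⁆) a

lemma translate_zero (h : Relations a s) : h.translate 0 = a := rfl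

lemma translate_cons (h : Relations a s) (i : ι) (m : Multiset ι) :
    h.translate (i ::ₘ m) = ⁅s (.inl i), h.translate m⁆ :=
  haveI := h.leftCommutative
  Multiset.foldr_cons _ _ _ _

lemma translate_val (h : Relations a s) (S : Finset ι) :
    h.translate S.val = word a (fun i => s (.inl i)) S.toList := by
  have := h.leftCommutative
  conv_lhs => rw [← Finset.coe_toList S]
  exact Multiset.coe_foldr _ _ _

lemma lie_inr_translate (h : Relations a s) (i : ι) (m : Multiset ι) :
    ⁅s (.inr i), h.translate m⁆ = h.translate (i ::ₘ i ::ₘ m) := by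
  induction m using Multiset.induction with
  | empty => simp only [translate_cons, translate_zero, h.sq]
  | cons j m ih =>
    rw [translate_cons, h.lie_lie_comm, ih]
    simp only [translate_cons]
    rw [h.lie_lie_comm (.inl j) (.inl i), h.lie_lie_comm (.inl j) (.inl i)]

lemma exists_lie_translate (h : Relations a s) (p : ι ⊕ ι) (m : Multiset ι) :
    ∃ m' : Multiset ι, m'.card ≤ m.card + 2 ∧ ⁅s p, h.translate m⁆ = h.translate m' := by
  rcases p with i | i
  · exact ⟨i ::ₘ m, by simp, (h.translate_cons i m).symm⟩
  · exact ⟨i ::ₘ i ::ₘ m, by simp, h.lie_inr_translate i m⟩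

/-- The derivation rule for the two families shows that two vanishing brackets propagate. -/
lemma lie_translate_cons (h : Relations a s) (k : Type*) [Field k] [LieAlgebra k L]
    (hchar : (2 : k) ≠ 0) {i : ι} {v w : Multiset ι}
    (h₀ : ⁅h.translate v, h.translate w⁆ = 0)
    (h₁ : ⁅h.translate (i ::ₘ v), h.translate w⁆ = 0) :
    ⁅h.translate v, h.translate (i ::ₘ w)⁆ = 0 ∧
      ⁅h.translate (i ::ₘ v), h.translate (i ::ₘ w)⁆ = 0 ∧
      ⁅h.translate (i ::ₘ i ::ₘ v), h.translate w⁆ = 0 := by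
  have der (x y : Multiset ι) : ⁅s (.inl i), ⁅h.translate x, h.translate y⁆⁆ =
      ⁅h.translate (i ::ₘ x), h.translate y⁆ + ⁅h.translate x, h.translate (i ::ₘ y)⁆ := by
    rw [leibniz_lie, translate_cons, translate_cons]
  have der₂ : ⁅s (.inr i), ⁅h.translate v, h.translate w⁆⁆ =
      ⁅h.translate (i ::ₘ i ::ₘ v), h.translate w⁆ +
        ⁅h.translate v, h.translate (i ::ₘ i ::ₘ w)⁆ := by
    rw [leibniz_lie, lie_inr_translate, lie_inr_translate]
  have hvw : ⁅h.translate v, h.translate (i ::ₘ w)⁆ = 0 := by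
    have := der v w
    rwa [h₀, h₁, lie_zero, zero_add, eq_comm] at this
  have e₁ := der (i ::ₘ v) w
  have e₂ := der v (i ::ₘ w)
  rw [h₁, lie_zero] at e₁
  rw [hvw, lie_zero] at e₂
  rw [h₀, lie_zero] at der₂
  have hd : (2 : k) • ⁅h.translate (i ::ₘ v), h.translate (i ::ₘ w)⁆ = 0 := by
    rw [two_smul]
    have : ⁅h.translate (i ::ₘ v), h.translate (i ::ₘ w)⁆ +
        ⁅h.translate (i ::ₘ v), h.translate (i ::ₘ w)⁆ =
        (⁅h.translate (i ::ₘ i ::ₘ v), h.translate w⁆ +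
          ⁅h.translate (i ::ₘ v), h.translate (i ::ₘ w)⁆) +
        (⁅h.translate (i ::ₘ v), h.translate (i ::ₘ w)⁆ +
          ⁅h.translate v, h.translate (i ::ₘ i ::ₘ w)⁆) -
        (⁅h.translate (i ::ₘ i ::ₘ v), h.translate w⁆ +
          ⁅h.translate v, h.translate (i ::ₘ i ::ₘ w)⁆) := by abel
    rw [this, ← e₁, ← e₂, ← der₂]
    simp
  have hd' := (smul_eq_zero.mp hd).resolve_left hchar
  refine ⟨hvw, hd', ?_⟩
  rwa [hd', add_zero, eq_comm] at e₁

lemma lie_translate_replicate (h : Relations a s) (k : Type*) [Field k] [LieAlgebra k L]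
    (hchar : (2 : k) ≠ 0) {i : ι} {v w : Multiset ι}
    (h₀ : ⁅h.translate v, h.translate w⁆ = 0)
    (h₁ : ⁅h.translate (i ::ₘ v), h.translate w⁆ = 0) (p q : ℕ) :
    ⁅h.translate (Multiset.replicate p i + v), h.translate (Multiset.replicate q i + w)⁆ = 0 := by
  induction p generalizing v with
  | zero =>
    induction q generalizing w with
    | zero => simpa using h₀
    | succ q ih =>
      obtain ⟨e₁, e₂, -⟩ := h.lie_translate_cons k hchar h₀ h₁
      simpa [Multiset.replicate_succ] using ih e₁ e₂
  | succ p ih =>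
    obtain ⟨-, -, e₃⟩ := h.lie_translate_cons k hchar h₀ h₁
    simpa [Multiset.replicate_succ] using ih h₁ e₃

lemma lie_translate_translate (h : Relations a s) (k : Type*) [Field k] [LieAlgebra k L]
    (hchar : (2 : k) ≠ 0) [Fintype ι] (v w : Multiset ι) :
    ⁅h.translate v, h.translate w⁆ = 0 := by
  let := Classical.decEq ι
  suffices key : ∀ A S : Finset ι, Disjoint A S → ∀ v w : Multiset ι, (∀ x ∈ v, x ∈ A) →
      (∀ x ∈ w, x ∈ A) → ⁅h.translate (v + S.val), h.translate w⁆ = 0 by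
    simpa using key Finset.univ ∅ (Finset.disjoint_empty_right _) v w (by simp) (by simp)
  intro A
  induction A using Finset.induction_on with
  | empty =>
    intro S _ v w hv hw
    rw [Multiset.eq_zero_of_forall_notMem (s := v) fun x hx => by simpa using hv x hx,
      Multiset.eq_zero_of_forall_notMem (s := w) fun x hx => by simpa using hw x hx, zero_add,
      translate_val]
    exact h.squarefree S
  | insert i A hi ih =>
    intro S hS v w hv hw
    obtain ⟨hiS, hAS⟩ := Finset.disjoint_insert_left.mp hS
    have split (m : Multiset ι) :
        m = Multiset.replicate (m.count i) i + m.filter (fun x => ¬ x = i) := by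
      conv_lhs => rw [← Multiset.filter_add_not (fun x => x = i) m, Multiset.filter_eq']
    have mem (m : Multiset ι) (hm : ∀ x ∈ m, x ∈ insert i A) :
        ∀ x ∈ m.filter (fun x => ¬ x = i), x ∈ A := fun x hx => by
      obtain ⟨hx, hne⟩ := Multiset.mem_filter.mp hx
      exact (Finset.mem_insert.mp (hm x hx)).resolve_left hne
    have h₀ := ih S hAS _ _ (mem v hv) (mem w hw)
    have h₁ := ih (insert i S) (Finset.disjoint_insert_right.mpr ⟨hi, hAS⟩) _ _
      (mem v hv) (mem w hw)
    rw [Finset.insert_val_of_notMem hiS, Multiset.add_cons] at h₁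
    have := h.lie_translate_replicate k hchar h₀ h₁ (v.count i) (w.count i)
    rwa [← add_assoc, ← split, ← split] at this

lemma bracketMonomial_cases (h : Relations a s) (k : Type*) [Field k] [LieAlgebra k L]
    (hchar : (2 : k) ≠ 0) [Fintype ι] {r : ℕ} {y : L}
    (hy : IsBracketMonomial (insert a (Set.range s)) r y) :
    1 ≤ r ∧ ((∃ p, y = s p) ∨
      ∃ (c : k) (m : Multiset ι), m.card ≤ 2 * r ∧ y = c • h.translate m) := by
  induction hy with
  | base hx =>
    refine ⟨le_rfl, ?_⟩
    rcases hx with rfl | ⟨p, rfl⟩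
    · exact .inr ⟨1, 0, by simp, by rw [one_smul, translate_zero]⟩
    · exact .inl ⟨p, rfl⟩
  | @br i j u v _ _ ihu ihv =>
    obtain ⟨hi, hu⟩ := ihu
    obtain ⟨hj, hv⟩ := ihv
    refine ⟨by omega, .inr ?_⟩
    rcases hu with ⟨p, rfl⟩ | ⟨c, m, hm, rfl⟩ <;> rcases hv with ⟨q, rfl⟩ | ⟨e, m', hm', rfl⟩
    · exact ⟨0, 0, by simp, by rw [h.comm, zero_smul]⟩
    · obtain ⟨n, hn, e'⟩ := h.exists_lie_translate p m'
      exact ⟨e, n, by omega, by rw [lie_smul, e']⟩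
    · obtain ⟨n, hn, e'⟩ := h.exists_lie_translate q m
      exact ⟨-c, n, by omega, by rw [smul_lie, ← lie_skew, e', smul_neg, neg_smul]⟩
    · exact ⟨0, 0, by simp, by
        rw [smul_lie, lie_smul, h.lie_translate_translate k hchar, smul_zero, smul_zero, zero_smul]⟩

lemma isBracketMonomial_translate (h : Relations a s) (m : Multiset ι) :
    IsBracketMonomial (insert a (Set.range s)) (1 + m.card) (h.translate m) := by
  induction m using Multiset.induction with
  | empty => exact .base (Set.mem_insert _ _)
  | cons i m ih =>
    rw [translate_cons, Multiset.card_cons, add_comm m.card 1]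
    exact .br (.base (Set.mem_insert_of_mem _ ⟨_, rfl⟩)) ih

end Relations

/-- The multiset with prescribed multiplicities. -/
def ofCounts [Fintype ι] (f : ι → ℕ) : Multiset ι := ∑ i, Multiset.replicate (f i) i

lemma count_ofCounts [Fintype ι] [DecidableEq ι] (f : ι → ℕ) (i : ι) :
    (ofCounts f).count i = f i := by
  simp [ofCounts, Multiset.count_sum', Multiset.count_replicate]

lemma ofCounts_count [Fintype ι] [DecidableEq ι] (m : Multiset ι) :
    ofCounts (fun i => m.count i) = m :=
  Multiset.ext.mpr fun i => count_ofCounts _ i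

lemma ofCounts_injective [Fintype ι] : Function.Injective (ofCounts (ι := ι)) := by
  classical
  intro f g hfg
  funext i
  rw [← count_ofCounts f i, hfg, count_ofCounts]

lemma card_ofCounts [Fintype ι] (f : ι → ℕ) : (ofCounts f).card = ∑ i, f i := by
  simp [ofCounts]

namespace Relations

variable {a : L} {s : ι ⊕ ι → L}

lemma span_le (h : Relations a s) (hchar : (2 : k) ≠ 0) [Fintype ι] (n : ℕ) :
    Submodule.span k {y : L | ∃ r, r ≤ n ∧ IsBracketMonomial (insert a (Set.range s)) r y} ≤
      Submodule.span k (Set.range (Sum.elim s fun f : ι → Fin (2 * n + 1) =>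
        h.translate (ofCounts fun i => (f i : ℕ)))) := by
  classical
  rw [Submodule.span_le]
  rintro y ⟨r, hr, hy⟩
  obtain ⟨-, ⟨p, rfl⟩ | ⟨c, m, hm, rfl⟩⟩ := h.bracketMonomial_cases k hchar hy
  · exact Submodule.subset_span ⟨.inl p, rfl⟩
  · refine Submodule.smul_mem _ _ (Submodule.subset_span ⟨.inr fun i => ⟨m.count i, ?_⟩, ?_⟩)
    · have := m.count_le_card i
      omega
    · simp [ofCounts_count]

lemma lieGrowth_le (h : Relations a s) (hchar : (2 : k) ≠ 0) [Fintype ι] (n : ℕ) :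
    lieGrowth k (insert a (Set.range s)) n ≤
      2 * Fintype.card ι + (2 * n + 1) ^ Fintype.card ι := by
  classical
  have := Module.Finite.span_of_finite k (Set.finite_range
    (Sum.elim s fun f : ι → Fin (2 * n + 1) => h.translate (ofCounts fun i => (f i : ℕ))))
  refine (Submodule.finrank_mono (h.span_le hchar n)).trans ((finrank_range_le_card _).trans ?_)
  simp [two_mul]

lemma le_lieGrowth (h : Relations a s) (hchar : (2 : k) ≠ 0) [Fintype ι]
    (hind : LinearIndependent k h.translate) {n N : ℕ} (hN : 1 + Fintype.card ι * n ≤ N) :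
    n ^ Fintype.card ι ≤ lieGrowth k (insert a (Set.range s)) N := by
  classical
  have := Module.Finite.span_of_finite k (Set.finite_range
    (Sum.elim s fun f : ι → Fin (2 * N + 1) => h.translate (ofCounts fun i => (f i : ℕ))))
  have := Submodule.finiteDimensional_of_le (h.span_le hchar N)
  have hinj : Function.Injective fun f : ι → Fin n => ofCounts fun i => (f i : ℕ) :=
    fun f g hfg => funext fun i => Fin.ext (congrFun (ofCounts_injective hfg) i)
  have hli := hind.comp _ hinj
  have hle : Submodule.span k (Set.range (h.translate ∘ fun f : ι → Fin n =>
      ofCounts fun i => (f i : ℕ))) ≤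
      Submodule.span k {y : L | ∃ r, r ≤ N ∧
        IsBracketMonomial (insert a (Set.range s)) r y} := by
    refine Submodule.span_mono ?_
    rintro _ ⟨f, rfl⟩
    refine ⟨_, le_trans ?_ hN, h.isBracketMonomial_translate _⟩
    rw [card_ofCounts, ← smul_eq_mul, ← Finset.card_univ]
    exact Nat.add_le_add_left (Finset.sum_le_card_nsmul _ _ _ fun i _ => (f i).2.le) 1
  have := Submodule.finrank_mono hle
  rw [finrank_span_eq_card hli] at this
  simpa [lieGrowth] using this

end Relations

end Relations

section Model

attribute [local instance] LieRing.ofAssociativeRing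

variable (k ι : Type*) [Field k]

/-- Matrices over a polynomial ring realize the wreath product: `upper p` is the translate by
`p` and `diag p` acts as multiplication by `p`. -/
noncomputable def upper (p : MvPolynomial ι k) : Matrix (Fin 2) (Fin 2) (MvPolynomial ι k) :=
  !![0, p; 0, 0]

/-- The matrix acting on `upper q` as multiplication by `p`. -/
noncomputable def diag (p : MvPolynomial ι k) : Matrix (Fin 2) (Fin 2) (MvPolynomial ι k) :=
  !![p, 0; 0, 0]

variable {k ι}

lemma lie_diag_diag (p q : MvPolynomial ι k) : ⁅diag k ι p, diag k ι q⁆ = 0 := by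
  ext i j
  fin_cases i <;> fin_cases j <;> simp [diag, Ring.lie_def, mul_comm]

lemma lie_diag_upper (p q : MvPolynomial ι k) :
    ⁅diag k ι p, upper k ι q⁆ = upper k ι (p * q) := by
  ext i j
  fin_cases i <;> fin_cases j <;> simp [diag, upper, Ring.lie_def]

lemma lie_upper_upper (p q : MvPolynomial ι k) : ⁅upper k ι p, upper k ι q⁆ = 0 := by
  ext i j
  fin_cases i <;> fin_cases j <;> simp [upper, Ring.lie_def]

/-- The images of the commuting generators in the matrix model. -/
noncomputable def torus (k : Type*) {ι : Type*} [Field k] :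
    ι ⊕ ι → Matrix (Fin 2) (Fin 2) (MvPolynomial ι k) :=
  Sum.elim (fun i => diag k ι (.X i)) fun i => diag k ι (.X i * .X i)

lemma exists_word_eq_upper (l : List ι) :
    ∃ p, word (upper k ι 1) (fun i => torus k (.inl i)) l = upper k ι p := by
  induction l with
  | nil => exact ⟨1, rfl⟩
  | cons i l ih =>
    obtain ⟨p, hp⟩ := ih
    exact ⟨.X i * p, by rw [← lie_diag_upper, ← hp]; rfl⟩

lemma relations_model : Relations (upper k ι 1) (torus k) where
  comm p q := by rcases p with i | i <;> rcases q with j | j <;> exact lie_diag_diag _ _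
  sq i := by simp [torus, lie_diag_upper]
  squarefree S := by
    obtain ⟨p, hp⟩ := exists_word_eq_upper (k := k) S.toList
    rw [hp, lie_upper_upper]

lemma linearIndependent_translate {L : Type*} [LieRing L] [LieAlgebra k L] {a : L}
    {s : ι ⊕ ι → L} (h : Relations a s)
    (g : L →ₗ⁅k⁆ Matrix (Fin 2) (Fin 2) (MvPolynomial ι k)) (hga : g a = upper k ι 1)
    (hgs : ∀ p, g (s p) = torus k p) : LinearIndependent k h.translate := by
  classical
  have hg (m : Multiset ι) :
      g (h.translate m) = upper k ι (MvPolynomial.monomial (Multiset.toFinsupp m) 1) := by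
    induction m using Multiset.induction with
    | empty => simpa [h.translate_zero] using hga
    | cons i m ih =>
      rw [h.translate_cons, LieHom.map_lie, hgs, ih, ← Multiset.singleton_add, map_add,
        Multiset.toFinsupp_singleton, torus, Sum.elim_inl, lie_diag_upper, MvPolynomial.X,
        MvPolynomial.monomial_mul, one_mul]
  refine LinearIndependent.of_comp
    (Matrix.entryLinearMap k (MvPolynomial ι k) (0 : Fin 2) (1 : Fin 2) ∘ₗ
      (g : L →ₗ[k] Matrix (Fin 2) (Fin 2) (MvPolynomial ι k))) ?_
  have hcoe : (Matrix.entryLinearMap k (MvPolynomial ι k) (0 : Fin 2) (1 : Fin 2) ∘ₗ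
      (g : L →ₗ[k] Matrix (Fin 2) (Fin 2) (MvPolynomial ι k))) ∘ h.translate =
      MvPolynomial.basisMonomials ι k ∘ Multiset.toFinsupp := by
    funext m
    simp [hg, upper]
  rw [hcoe]
  exact (MvPolynomial.basisMonomials ι k).linearIndependent.comp _ Multiset.toFinsupp.injective

end Model

section Presentation

variable {k L ι : Type*} [Field k] [LieRing L] [LieAlgebra k L]

/-- The relators corresponding to `Relations`. -/
noncomputable def relator (a : L) (s : ι ⊕ ι → L) :
    ((ι ⊕ ι) × (ι ⊕ ι)) ⊕ ι ⊕ Finset ι → L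
  | .inl (p, q) => ⁅s p, s q⁆
  | .inr (.inl i) => ⁅s (.inr i), a⁆ - ⁅s (.inl i), ⁅s (.inl i), a⁆⁆
  | .inr (.inr S) => ⁅word a (fun i => s (.inl i)) S.toList, a⁆

lemma relations_iff {a : L} {s : ι ⊕ ι → L} :
    Relations a s ↔ ∀ r, relator a s r = 0 := by
  constructor
  · rintro h (⟨p, q⟩ | i | S)
    · exact h.comm p q
    · exact sub_eq_zero.mpr (h.sq i)
    · exact h.squarefree S
  · exact fun h => ⟨fun p q => h (.inl (p, q)), fun i => sub_eq_zero.mp (h (.inr (.inl i))),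
      fun S => h (.inr (.inr S))⟩

lemma map_word {L' : Type*} [LieRing L'] [LieAlgebra k L'] (g : L →ₗ⁅k⁆ L') (a : L) (t : ι → L)
    (l : List ι) : g (word a t l) = word (g a) (fun i => g (t i)) l := by
  induction l with
  | nil => rfl
  | cons i l ih => exact (g.map_lie _ _).trans (congrArg _ ih)

lemma map_relator {L' : Type*} [LieRing L'] [LieAlgebra k L'] (g : L →ₗ⁅k⁆ L') (a : L)
    (s : ι ⊕ ι → L) (r : ((ι ⊕ ι) × (ι ⊕ ι)) ⊕ ι ⊕ Finset ι) :
    g (relator a s r) = relator (g a) (fun p => g (s p)) r := by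
  rcases r with ⟨p, q⟩ | i | S <;> simp [relator, map_word]

/-- The quotient homomorphism by a Lie ideal. -/
def quotientHom (N : LieIdeal k L) : L →ₗ⁅k⁆ L ⧸ N :=
  { (LieSubmodule.Quotient.mk' N : L →ₗ[k] L ⧸ N) with map_lie' := rfl }

/-- The homomorphism induced on the quotient by a Lie ideal contained in the kernel. -/
def quotientLift {L' : Type*} [LieRing L'] [LieAlgebra k L'] (N : LieIdeal k L) (g : L →ₗ⁅k⁆ L')
    (hN : N ≤ g.ker) : L ⧸ N →ₗ⁅k⁆ L' :=
  { Submodule.liftQ N.toSubmodule (g : L →ₗ[k] L') (fun x hx => by simpa using hN hx) with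
    map_lie' := by
      rintro ⟨x⟩ ⟨y⟩
      exact g.map_lie x y }

end Presentation

end BaumslagWreath

/-- For every `d ≥ 1` there is a finitely presented Lie algebra over a field of
characteristic ≠ 2 — a quotient of a free Lie algebra on finitely many generators
by the ideal generated by finitely many relations — whose growth function is
equivalent to `n^d`. -/
theorem exists_finitely_presented_polynomial_growth (k : Type*) [Field k]
    (hchar : (2 : k) ≠ 0) (d : ℕ) (hd : 1 ≤ d) :
    ∃ (m : ℕ) (rels : Finset (FreeLieAlgebra k (Fin m))) (C : ℕ), 0 < C ∧
      ∀ n : ℕ, 1 ≤ n →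
        (lieGrowth k (Set.range fun i : Fin m =>
            (LieSubmodule.Quotient.mk
              (N := LieSubmodule.lieSpan k (FreeLieAlgebra k (Fin m))
                (rels : Set (FreeLieAlgebra k (Fin m))))
              (FreeLieAlgebra.of k i))) n ≤ C * (C * n) ^ d) ∧
        (n ^ d ≤ C * lieGrowth k (Set.range fun i : Fin m =>
            (LieSubmodule.Quotient.mk
              (N := LieSubmodule.lieSpan k (FreeLieAlgebra k (Fin m))
                (rels : Set (FreeLieAlgebra k (Fin m))))
              (FreeLieAlgebra.of k i))) (C * n)) := by
  let : LieRing (Matrix (Fin 2) (Fin 2) (MvPolynomial (Fin d) k)) := LieRing.ofAssociativeRing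
  let e : Option (Fin d ⊕ Fin d) ≃ Fin (d + d + 1) :=
    (Equiv.optionCongr finSumFinEquiv).trans (finSuccEquiv (d + d)).symm
  let a₀ : FreeLieAlgebra k (Fin (d + d + 1)) := .of k (e none)
  let s₀ (p : Fin d ⊕ Fin d) : FreeLieAlgebra k (Fin (d + d + 1)) := .of k (e (some p))
  let rels := (Set.finite_range (BaumslagWreath.relator a₀ s₀)).toFinset
  let N : LieIdeal k (FreeLieAlgebra k (Fin (d + d + 1))) :=
    LieSubmodule.lieSpan k _ (rels : Set (FreeLieAlgebra k (Fin (d + d + 1))))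
  let π := BaumslagWreath.quotientHom N
  have hrel : BaumslagWreath.Relations (π a₀) (fun p => π (s₀ p)) := by
    rw [BaumslagWreath.relations_iff]
    intro r
    rw [← BaumslagWreath.map_relator]
    refine (LieSubmodule.Quotient.mk_eq_zero').mpr (LieSubmodule.subset_lieSpan ?_)
    simp [rels]
  let g := FreeLieAlgebra.lift k fun i =>
    (e.symm i).elim (BaumslagWreath.upper k (Fin d) 1) (BaumslagWreath.torus k)
  have hga : g a₀ = BaumslagWreath.upper k (Fin d) 1 := by simp [g, a₀]
  have hgs (p : Fin d ⊕ Fin d) : g (s₀ p) = BaumslagWreath.torus k p := by simp [g, s₀]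
  have hN : N ≤ g.ker := by
    refine LieSubmodule.lieSpan_le.mpr fun x hx => ?_
    obtain ⟨r, rfl⟩ : x ∈ Set.range (BaumslagWreath.relator a₀ s₀) := by simpa [rels] using hx
    refine LieHom.mem_ker.mpr ?_
    rw [BaumslagWreath.map_relator, hga, funext hgs]
    exact BaumslagWreath.relations_iff.mp BaumslagWreath.relations_model r
  have hind := BaumslagWreath.linearIndependent_translate hrel
    (BaumslagWreath.quotientLift N g hN) hga hgs
  have hgen : (Set.range fun i => (LieSubmodule.Quotient.mk (N := N) (FreeLieAlgebra.of k i))) =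
      insert (π a₀) (Set.range fun p => π (s₀ p)) := by
    rw [← e.surjective.range_comp, Option.range_eq]
    rfl
  refine ⟨d + d + 1, rels, 2 * d + 3, by omega, fun n hn => ?_⟩
  change lieGrowth k (Set.range fun i => (LieSubmodule.Quotient.mk (N := N)
      (FreeLieAlgebra.of k i))) n ≤ _ ∧ _ ≤ _ * lieGrowth k (Set.range fun i =>
        (LieSubmodule.Quotient.mk (N := N) (FreeLieAlgebra.of k i))) _
  rw [hgen]
  constructor
  · refine (hrel.lieGrowth_le hchar n).trans ?_
    rw [Fintype.card_fin]
    have h₁ : (2 * n + 1) ^ d ≤ ((2 * d + 3) * n) ^ d := Nat.pow_le_pow_left (by nlinarith) d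
    have h₂ : 1 ≤ ((2 * d + 3) * n) ^ d := Nat.one_le_pow _ _ (by positivity)
    nlinarith
  · have := hrel.le_lieGrowth hchar hind (n := n) (N := (2 * d + 3) * n)
      (by rw [Fintype.card_fin]; nlinarith)
    rw [Fintype.card_fin] at this
    exact this.trans (Nat.le_mul_of_pos_left _ (by omega))
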